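/- Let δ₁,…,δₙ be positive integers, let N = J × … × J ⊆ R^s (s factors) where J = ⟨X₁^{δ₁},…,Xₙ^{δₙ}⟩ ⊆ R, let F ∈ R^{r×s}, and let ≤ be a monomial order on R^r. Then for every i ∈ {1,…,n}, each element of the reduced ≤-Gröbner basis of Syz_N(F) either has degree in the variable X_i strictly less than δ_i, or is equal to the monomial X_i^{δ_i}e_j for some 1 ≤ j ≤ r. -/

import Mathlib

open MvPolynomial

/-! ### Monomials of the free module `R^r`, monomial orders, Gröbner bases

Here `R = K[X₁,…,Xₙ]` is `MvPolynomial (Fin n) K` and the free module `R^r`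
is `Fin r → MvPolynomial (Fin n) K` (row vectors).  A monomial `ν eᵢ` of `R^r`
is encoded as a pair `(ν, i)`. -/

/-- A monomial of the free module `R^r`: an exponent vector in `n` variables
together with the index of the coordinate vector supporting it. -/
abbrev ModMon (n r : ℕ) := (Fin n →₀ ℕ) × Fin r

/-- Multiplication of a module monomial by a ring monomial. -/
noncomputable def smulMon {n r : ℕ} (ν : Fin n →₀ ℕ) (μ : ModMon n r) : ModMon n r :=
  (ν + μ.1, μ.2)

/-- A monomial order on `R^r`: a total order on the monomials of `R^r` such that
`μ₁ ≤ μ₂` implies `μ₁ ≤ ν·μ₁ ≤ ν·μ₂` for every ring monomial `ν`. -/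
structure ModMonomialOrder (n r : ℕ) where
  le : ModMon n r → ModMon n r → Prop
  le_refl : ∀ a, le a a
  le_trans : ∀ a b c, le a b → le b c → le a c
  le_antisymm : ∀ a b, le a b → le b a → a = b
  le_total : ∀ a b, le a b ∨ le b a
  compat : ∀ (ν : Fin n →₀ ℕ) (a b : ModMon n r),
    le a b → le a (smulMon ν a) ∧ le (smulMon ν a) (smulMon ν b)

/-- The strict order associated with a monomial order. -/
def ModMonomialOrder.lt {n r : ℕ} (ord : ModMonomialOrder n r)
    (a b : ModMon n r) : Prop :=
  ord.le a b ∧ a ≠ b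

/-- The module monomial `μ = ν eᵢ` as an element of `R^r`. -/
noncomputable def monElem (K : Type) [Field K] {n r : ℕ} (μ : ModMon n r) :
    Fin r → MvPolynomial (Fin n) K :=
  Pi.single μ.2 (monomial μ.1 (1 : K))

/-- `μ` is the `ord`-leading monomial of `p ∈ R^r`: it appears in `p` and every
monomial appearing in `p` is `≤ μ`. -/
def IsLM {K : Type} [Field K] {n r : ℕ} (ord : ModMonomialOrder n r)
    (p : Fin r → MvPolynomial (Fin n) K) (μ : ModMon n r) : Prop :=
  coeff μ.1 (p μ.2) ≠ 0 ∧
  ∀ (m : Fin n →₀ ℕ) (i : Fin r), coeff m (p i) ≠ 0 → ord.le (m, i) μ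

/-- Divisibility of module monomials: `μ ∣ μ'` iff `μ' = ν·μ` for a ring monomial `ν`. -/
def monDvd {n r : ℕ} (μ μ' : ModMon n r) : Prop :=
  ∃ ν : Fin n →₀ ℕ, smulMon ν μ = μ'

/-- The `ord`-leading module of a submodule `M ⊆ R^r`: the submodule generated by
the leading monomials of the nonzero elements of `M`. -/
noncomputable def leadingSubmodule {K : Type} [Field K] {n r : ℕ}
    (ord : ModMonomialOrder n r)
    (M : Submodule (MvPolynomial (Fin n) K) (Fin r → MvPolynomial (Fin n) K)) :
    Submodule (MvPolynomial (Fin n) K) (Fin r → MvPolynomial (Fin n) K) :=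
  Submodule.span (MvPolynomial (Fin n) K)
    {v | ∃ p ∈ M, ∃ μ : ModMon n r, IsLM ord p μ ∧ v = monElem K μ}

/-- `G` is a `ord`-Gröbner basis of `M`. -/
def IsGB {K : Type} [Field K] {n r : ℕ} {ι : Type} (ord : ModMonomialOrder n r)
    (M : Submodule (MvPolynomial (Fin n) K) (Fin r → MvPolynomial (Fin n) K))
    (G : ι → Fin r → MvPolynomial (Fin n) K) : Prop :=
  (∀ i, G i ∈ M) ∧
  leadingSubmodule ord M =
    Submodule.span (MvPolynomial (Fin n) K)
      {v | ∃ (i : ι) (μ : ModMon n r), IsLM ord (G i) μ ∧ v = monElem K μ}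

/-- `G` is a minimal `ord`-Gröbner basis of `M`: no leading monomial of an element
divides that of another element. -/
def IsMinimalGB {K : Type} [Field K] {n r : ℕ} {ι : Type} (ord : ModMonomialOrder n r)
    (M : Submodule (MvPolynomial (Fin n) K) (Fin r → MvPolynomial (Fin n) K))
    (G : ι → Fin r → MvPolynomial (Fin n) K) : Prop :=
  IsGB ord M G ∧
  ∀ (i j : ι), i ≠ j → ∀ (μi μj : ModMon n r),
    IsLM ord (G i) μi → IsLM ord (G j) μj → ¬ monDvd μi μj

/-- `G` is the reduced `ord`-Gröbner basis of `M`: minimal, leading coefficients `1`,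
and no term of `G i` is divisible by the leading monomial of `G j` for `j ≠ i`. -/
def IsReducedGB {K : Type} [Field K] {n r : ℕ} {ι : Type} (ord : ModMonomialOrder n r)
    (M : Submodule (MvPolynomial (Fin n) K) (Fin r → MvPolynomial (Fin n) K))
    (G : ι → Fin r → MvPolynomial (Fin n) K) : Prop :=
  IsMinimalGB ord M G ∧
  (∀ (i : ι) (μi : ModMon n r), IsLM ord (G i) μi → coeff μi.1 (G i μi.2) = 1) ∧
  (∀ (i j : ι), i ≠ j → ∀ (μj : ModMon n r), IsLM ord (G j) μj →
    ∀ (m : Fin n →₀ ℕ) (l : Fin r), coeff m (G i l) ≠ 0 → ¬ monDvd μj (m, l))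

/-- The rows of the elementary matrix `E ∈ R^{(k+n-1)×k}` with pivot `π`,
constants `lam i` (for `i ≠ π`) and `α j`: the rows `εᵢ + λᵢ ε_π` for `i ≠ π`
and `(Xⱼ - αⱼ) ε_π` for `1 ≤ j ≤ n`. -/
noncomputable def elemRow {K : Type} [Field K] {n k : ℕ} (π : Fin k)
    (lam : Fin k → K) (α : Fin n → K) :
    ({i : Fin k // i ≠ π} ⊕ Fin n) → Fin k → MvPolynomial (Fin n) K :=
  Sum.elim
    (fun i => Pi.single i.1 (1 : MvPolynomial (Fin n) K)
      + lam i.1 • (Pi.single π 1 : Fin k → MvPolynomial (Fin n) K))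
    (fun j => (X j - C (α j)) • (Pi.single π 1 : Fin k → MvPolynomial (Fin n) K))

/-- Rows of the matrix product `E·G` where `E` has rows in `R^k` indexed by `ι`
and `G ∈ R^{k×r}`. -/
noncomputable def rowMul {K : Type} [Field K] {n k r : ℕ} {ι : Type}
    (E : ι → Fin k → MvPolynomial (Fin n) K)
    (G : Fin k → Fin r → MvPolynomial (Fin n) K) :
    ι → Fin r → MvPolynomial (Fin n) K :=
  fun a c => ∑ b, E a b * G b c

/-- `sord` is a Schreyer order for `ord` and the list of monomials `LM`. -/
def IsSchreyerOrder {n r k : ℕ} (ord : ModMonomialOrder n r)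
    (LM : Fin k → ModMon n r) (sord : ModMonomialOrder n k) : Prop :=
  ∀ (ν₁ ν₂ : Fin n →₀ ℕ) (i j : Fin k),
    ord.lt (smulMon ν₁ (LM i)) (smulMon ν₂ (LM j)) → sord.le (ν₁, i) (ν₂, j)

/-- Row vector times matrix, as a linear map `R^r → R^s`. -/
noncomputable def vecMulLin {K : Type} [Field K] {n r s : ℕ}
    (F : Fin r → Fin s → MvPolynomial (Fin n) K) :
    (Fin r → MvPolynomial (Fin n) K) →ₗ[MvPolynomial (Fin n) K]
      (Fin s → MvPolynomial (Fin n) K) :=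
  Matrix.vecMulLinear (Matrix.of F)

/-- The syzygy module `Syz_N(F) = {p ∈ R^r : pF ∈ N}`. -/
noncomputable def Syz {K : Type} [Field K] {n r s : ℕ}
    (N : Submodule (MvPolynomial (Fin n) K) (Fin s → MvPolynomial (Fin n) K))
    (F : Fin r → Fin s → MvPolynomial (Fin n) K) :
    Submodule (MvPolynomial (Fin n) K) (Fin r → MvPolynomial (Fin n) K) :=
  Submodule.comap (vecMulLin F) N

/-- `keepIdx K μ π j` holds iff `Xⱼ·μ_π` does not belong to the submodule of `R^r`
generated by the monomials `μ i`, `i ≠ π`. -/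
def keepIdx (K : Type) [Field K] {n r k : ℕ} (μ : Fin k → ModMon n r) (π : Fin k)
    (j : Fin n) : Prop :=
  monElem K (smulMon (Finsupp.single j 1) (μ π)) ∉
    Submodule.span (MvPolynomial (Fin n) K)
      {v | ∃ i : Fin k, i ≠ π ∧ v = monElem K (μ i)}

/-- The rows of the submatrix of the elementary matrix with pivot `π` keeping,
among the rows `(Xⱼ - αⱼ) ε_π`, only those with `P j`. -/
noncomputable def prunedRow {K : Type} [Field K] {n k : ℕ} (π : Fin k)
    (lam : Fin k → K) (α : Fin n → K) (P : Fin n → Prop) :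
    ({i : Fin k // i ≠ π} ⊕ {j : Fin n // P j}) → Fin k → MvPolynomial (Fin n) K :=
  Sum.elim
    (fun i => Pi.single i.1 (1 : MvPolynomial (Fin n) K)
      + lam i.1 • (Pi.single π 1 : Fin k → MvPolynomial (Fin n) K))
    (fun j => (X j.1 - C (α j.1)) • (Pi.single π 1 : Fin k → MvPolynomial (Fin n) K))

theorem eq_of_coeff_monElem_ne_zero {K : Type} [Field K] {n r : ℕ} {μ η : ModMon n r}
    (h : coeff η.1 (monElem K μ η.2) ≠ 0) : η = μ := by
  by_cases hl : η.2 = μ.2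
  · refine Prod.ext ?_ hl
    by_contra hne
    simp [monElem, coeff_monomial, hl, Ne.symm hne] at h
  · simp [monElem, hl] at h

theorem exists_monDvd_of_mem_span {K : Type} [Field K] {n r : ℕ} (S : Set (ModMon n r))
    {p : Fin r → MvPolynomial (Fin n) K}
    (hp : p ∈ Submodule.span (MvPolynomial (Fin n) K) (monElem K '' S)) :
    ∀ (m : Fin n →₀ ℕ) (l : Fin r), coeff m (p l) ≠ 0 → ∃ μ ∈ S, monDvd μ (m, l) := by
  induction hp using Submodule.span_induction with
  | mem x hx =>
    obtain ⟨μ, hμ, rfl⟩ := hx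
    intro m l h
    refine ⟨μ, hμ, 0, ?_⟩
    rw [← eq_of_coeff_monElem_ne_zero (η := (m, l)) h]
    simp [smulMon]
  | zero => simp
  | add x y _ _ hx hy =>
    intro m l h
    by_cases h0 : coeff m (x l) = 0
    · exact hy m l (by simpa [h0] using h)
    · exact hx m l h0
  | smul f x _ hx =>
    intro m l h
    rw [Pi.smul_apply, smul_eq_mul, coeff_mul] at h
    obtain ⟨⟨u, v⟩, huv, hne⟩ := Finset.exists_ne_zero_of_sum_ne_zero h
    rw [Finset.HasAntidiagonal.mem_antidiagonal] at huv
    obtain ⟨μ, hμ, ν, hν⟩ := hx v l (right_ne_zero_of_mul hne)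
    refine ⟨μ, hμ, u + ν, ?_⟩
    simp only [smulMon, Prod.mk.injEq] at hν ⊢
    exact ⟨by rw [add_assoc, hν.1, huv], hν.2⟩

theorem ModMonomialOrder.le_of_monDvd {n r : ℕ} (ord : ModMonomialOrder n r)
    {μ μ' : ModMon n r} (h : monDvd μ μ') : ord.le μ μ' := by
  obtain ⟨ν, rfl⟩ := h
  exact (ord.compat ν μ μ (ord.le_refl μ)).1

theorem monDvd_trans {n r : ℕ} {a b c : ModMon n r} (hab : monDvd a b) (hbc : monDvd b c) :
    monDvd a c := by
  obtain ⟨u, rfl⟩ := hab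
  obtain ⟨v, rfl⟩ := hbc
  exact ⟨v + u, by simp [smulMon, add_assoc]⟩

theorem ModMonomialOrder.exists_max {n r : ℕ} (ord : ModMonomialOrder n r)
    (s : Finset (ModMon n r)) (hs : s.Nonempty) : ∃ μ ∈ s, ∀ x ∈ s, ord.le x μ := by
  induction hs using Finset.Nonempty.cons_induction with
  | singleton a => exact ⟨a, by simp, by simpa using ord.le_refl a⟩
  | cons a s _ _ ih =>
    obtain ⟨μ, hμ, hmax⟩ := ih
    rcases ord.le_total a μ with h | h
    · exact ⟨μ, by simp [hμ], by simpa using ⟨h, fun x y => hmax (x, y)⟩⟩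
    · refine ⟨a, by simp, ?_⟩
      simpa using ⟨ord.le_refl a, fun x y hx => ord.le_trans _ _ _ (hmax (x, y) hx) h⟩

theorem exists_isLM {K : Type} [Field K] {n r : ℕ} (ord : ModMonomialOrder n r)
    {p : Fin r → MvPolynomial (Fin n) K} (hp : p ≠ 0) : ∃ μ, IsLM ord p μ := by
  let s : Finset (ModMon n r) :=
    Finset.univ.biUnion fun c => (p c).support.image fun m => (m, c)
  have hs : ∀ m c, (m, c) ∈ s ↔ coeff m (p c) ≠ 0 := by
    intro m c
    simp [s]
  have hne : s.Nonempty := by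
    obtain ⟨c, hc⟩ := Function.ne_iff.mp hp
    obtain ⟨m, hm⟩ := ne_zero_iff.mp hc
    exact ⟨(m, c), (hs m c).2 hm⟩
  obtain ⟨μ, hμ, hmax⟩ := ord.exists_max s hne
  exact ⟨μ, (hs _ _).1 hμ, fun m i h => hmax _ ((hs m i).2 h)⟩

theorem IsGB.exists_monDvd {K : Type} [Field K] {n r : ℕ} {ι : Type}
    {ord : ModMonomialOrder n r}
    {M : Submodule (MvPolynomial (Fin n) K) (Fin r → MvPolynomial (Fin n) K)}
    {G : ι → Fin r → MvPolynomial (Fin n) K} (hG : IsGB ord M G)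
    {p : Fin r → MvPolynomial (Fin n) K} (hp : p ∈ M) {μ : ModMon n r} (hμ : IsLM ord p μ) :
    ∃ b μb, IsLM ord (G b) μb ∧ monDvd μb μ := by
  have h : monElem K μ ∈ leadingSubmodule ord M :=
    Submodule.subset_span ⟨p, hp, μ, hμ, rfl⟩
  rw [hG.2] at h
  have hset : {v | ∃ (i : ι) (μ : ModMon n r), IsLM ord (G i) μ ∧ v = monElem K μ} =
      monElem K '' {μ | ∃ i, IsLM ord (G i) μ} := by
    ext v
    constructor
    · rintro ⟨i, μ, hi, rfl⟩
      exact ⟨μ, ⟨i, hi⟩, rfl⟩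
    · rintro ⟨μ, ⟨i, hi⟩, rfl⟩
      exact ⟨i, μ, hi, rfl⟩
  rw [hset] at h
  obtain ⟨μb, ⟨b, hb⟩, hdvd⟩ :=
    exists_monDvd_of_mem_span _ h μ.1 μ.2 (by simp [monElem])
  exact ⟨b, μb, hb, hdvd⟩

theorem isLM_monElem {K : Type} [Field K] {n r : ℕ} (ord : ModMonomialOrder n r)
    (μ : ModMon n r) : IsLM ord (monElem K μ) μ := by
  refine ⟨by simp [monElem], fun m l h => ?_⟩
  rw [eq_of_coeff_monElem_ne_zero (η := (m, l)) h]
  exact ord.le_refl μ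

/-- If a term of an element of a reduced Gröbner basis is divisible by a monomial of the
module, then the element equals that monomial. -/
theorem IsReducedGB.eq_monElem {K : Type} [Field K] {n r : ℕ} {ι : Type}
    {ord : ModMonomialOrder n r}
    {M : Submodule (MvPolynomial (Fin n) K) (Fin r → MvPolynomial (Fin n) K)}
    {G : ι → Fin r → MvPolynomial (Fin n) K} (hG : IsReducedGB ord M G)
    {μ : ModMon n r} (hμ : monElem K μ ∈ M) {a : ι} {m : Fin n →₀ ℕ} {c : Fin r}
    (hm : coeff m (G a c) ≠ 0) (hdvd : monDvd μ (m, c)) : G a = monElem K μ := by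
  obtain ⟨⟨hGB, -⟩, hlc, hred⟩ := hG
  obtain ⟨b, μb, hb, hbμ⟩ := hGB.exists_monDvd hμ (isLM_monElem ord μ)
  obtain rfl : a = b := by
    by_contra hne
    exact hred a b hne μb hb m c hm (monDvd_trans hbμ hdvd)
  obtain rfl : μb = μ := ord.le_antisymm _ _ (ord.le_of_monDvd hbμ)
    (ord.le_trans _ _ _ (ord.le_of_monDvd hdvd) (hb.2 m c hm))
  by_contra hne
  obtain ⟨η, hη⟩ := exists_isLM ord (sub_ne_zero.2 hne)
  have hημ : η ≠ μb := by
    rintro rfl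
    apply hη.1
    simp [monElem, hlc a η hb]
  have hηa : coeff η.1 (G a η.2) ≠ 0 := by
    intro h0
    apply hη.1
    rw [Pi.sub_apply, coeff_sub, h0, zero_sub, neg_eq_zero]
    by_contra h
    exact hημ (eq_of_coeff_monElem_ne_zero h)
  obtain ⟨d, μd, hd, hdη⟩ := hGB.exists_monDvd (M.sub_mem (hGB.1 a) hμ) hη
  obtain rfl : a = d := by
    by_contra hne
    exact hred a d hne μd hd η.1 η.2 hηa hdη
  have hdb : ord.le μb μd := hd.2 _ _ hb.1
  exact hημ (ord.le_antisymm _ _ (hb.2 _ _ hηa)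
    (ord.le_trans _ _ _ hdb (ord.le_of_monDvd hdη)))

/-- For `N = J × … × J` with `J = ⟨X₁^{δ₁},…,Xₙ^{δₙ}⟩`, every
element of the reduced `≤`-Gröbner basis of `Syz_N(F)` either has `Xᵢ`-degree
less than `δᵢ` (for each `i`), or equals the monomial `Xᵢ^{δᵢ} eⱼ`. -/
theorem statement15 {K : Type} [Field K] {n r s : ℕ}
    (δ : Fin n → ℕ) (hδ : ∀ i, 0 < δ i)
    (N : Submodule (MvPolynomial (Fin n) K) (Fin s → MvPolynomial (Fin n) K))
    (hN : N = Submodule.pi Set.univ (fun _ : Fin s =>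
      Ideal.span (Set.range (fun i : Fin n => (X i : MvPolynomial (Fin n) K) ^ δ i))))
    (F : Fin r → Fin s → MvPolynomial (Fin n) K)
    (ord : ModMonomialOrder n r)
    {k : ℕ} (G : Fin k → Fin r → MvPolynomial (Fin n) K)
    (hG : IsReducedGB ord (Syz N F) G) :
    ∀ (i : Fin n) (a : Fin k),
      (∀ c : Fin r, MvPolynomial.degreeOf i (G a c) < δ i) ∨
      (∃ j : Fin r, G a =
        Pi.single j (monomial (Finsupp.single i (δ i)) (1 : K))) := by
  intro i a
  by_cases hdeg : ∀ c : Fin r, degreeOf i (G a c) < δ i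
  · exact Or.inl hdeg
  right
  push Not at hdeg
  obtain ⟨c, hc⟩ := hdeg
  have hex : ∃ m ∈ (G a c).support, δ i ≤ m i := by
    by_contra! hlt
    exact absurd ((degreeOf_lt_iff (hδ i)).2 hlt) hc.not_gt
  obtain ⟨m, hm, hmi⟩ := hex
  refine ⟨c, hG.eq_monElem (μ := (Finsupp.single i (δ i), c)) ?_ (mem_support_iff.1 hm)
    ⟨m - Finsupp.single i (δ i), ?_⟩⟩
  · subst hN
    rw [Syz, Submodule.mem_comap, Submodule.mem_pi]
    intro j _
    have hval : vecMulLin F (monElem K (Finsupp.single i (δ i), c)) j = F c j * X i ^ δ i := by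
      simp [vecMulLin, monElem, Matrix.single_vecMul, X_pow_eq_monomial, mul_comm]
    rw [hval]
    exact Ideal.mul_mem_left _ _ (Ideal.subset_span ⟨i, rfl⟩)
  · simp only [smulMon, Prod.mk.injEq, and_true]
    exact tsub_add_cancel_of_le (by simpa using hmi)
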